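/- arXiv:2401.12556 — 7 statements merged into one kernel-verified Lean document; each statement's English description precedes it below -/
import Mathlib

section
/- Let A : ℝ^n → ℝ^n and B : ℝ^m → ℝ^n be linear maps, let U ⊆ ℝ^m and S ⊆ ℝ^n be convex sets, let v_1, …, v_l ∈ ℝ^n, and let W = convexHull{v_1, …, v_l}. Fix y ∈ ℝ^n and suppose there are inputs u_1, …, u_l ∈ U such that for every i ∈ {1,…,l} and every w ∈ W one has A(y + v_i) + B u_i + w ∈ S. Then for every w ∈ W and every choice of convex coefficients λ_1, …, λ_l (λ_i ≥ 0, Σ_i λ_i = 1) with w = Σ_i λ_i v_i, the input u = Σ_i λ_i u_i satisfies u ∈ U and A(y + w) + B u + w' ∈ S for every w' ∈ W. -/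
/-- Proposition 2: the convex combination of the vertex inputs is an admissible input
that robustly steers every perturbed state into the convex safe set `S`. -/
theorem convex_vertex_policy_valid {n m l : ℕ}
    (A : EuclideanSpace ℝ (Fin n) →ₗ[ℝ] EuclideanSpace ℝ (Fin n))
    (B : EuclideanSpace ℝ (Fin m) →ₗ[ℝ] EuclideanSpace ℝ (Fin n))
    (U : Set (EuclideanSpace ℝ (Fin m))) (hU : Convex ℝ U)
    (S : Set (EuclideanSpace ℝ (Fin n))) (hS : Convex ℝ S)
    (v : Fin l → EuclideanSpace ℝ (Fin n))
    (W : Set (EuclideanSpace ℝ (Fin n))) (hW : W = convexHull ℝ (Set.range v))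
    (y : EuclideanSpace ℝ (Fin n))
    (u : Fin l → EuclideanSpace ℝ (Fin m)) (hu : ∀ i, u i ∈ U)
    (hsteer : ∀ i, ∀ w ∈ W, A (y + v i) + B (u i) + w ∈ S) :
    ∀ w ∈ W, ∀ lam : Fin l → ℝ, (∀ i, 0 ≤ lam i) → (∑ i, lam i) = 1 →
      w = ∑ i, lam i • v i →
        (∑ i, lam i • u i) ∈ U ∧
        ∀ w' ∈ W, A (y + w) + B (∑ i, lam i • u i) + w' ∈ S := by
  intro w _ lam h0 h1 hw
  refine ⟨hU.sum_mem (fun i _ => h0 i) h1 (fun i _ => hu i), fun w' hw' => ?_⟩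
  have h := hS.sum_mem (t := Finset.univ) (fun i _ => h0 i) h1
    (fun i _ => hsteer i w' hw')
  have e : ∑ i, lam i • (A (y + v i) + B (u i) + w')
      = A (y + w) + B (∑ i, lam i • u i) + w' := by
    simp only [hw, map_add, map_sum, map_smul, smul_add, Finset.sum_add_distrib,
      ← Finset.sum_smul, h1, one_smul]
  rwa [e] at h
end

section
/- Let A : ℝ^n → ℝ^n and B : ℝ^m → ℝ^n be linear maps, let U ⊆ ℝ^m be a convex set, let W ⊆ ℝ^n be a set, and let x_1, …, x_N ∈ ℝ^n and u_1, …, u_N ∈ U be such that for every i ∈ {1,…,N} and every w ∈ W one has A x_i + B u_i + w ∈ convexHull{x_1, …, x_N}. Then for every x ∈ convexHull{x_1, …, x_N} and every choice of convex coefficients λ_1, …, λ_N (λ_i ≥ 0, Σ_i λ_i = 1) with x = Σ_i λ_i x_i, the input u = Σ_i λ_i u_i satisfies u ∈ U and A x + B u + w ∈ convexHull{x_1, …, x_N} for every w ∈ W. -/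
/-- Proposition 3 (core): the convex hull of stored states, each with a stored admissible
input robustly steering it back into the hull, is robust positive invariant under the
convex-combination policy. -/
theorem safe_set_robust_positive_invariant {n m N : ℕ}
    (A : EuclideanSpace ℝ (Fin n) →ₗ[ℝ] EuclideanSpace ℝ (Fin n))
    (B : EuclideanSpace ℝ (Fin m) →ₗ[ℝ] EuclideanSpace ℝ (Fin n))
    (U : Set (EuclideanSpace ℝ (Fin m))) (hU : Convex ℝ U)
    (W : Set (EuclideanSpace ℝ (Fin n)))
    (x : Fin N → EuclideanSpace ℝ (Fin n))
    (u : Fin N → EuclideanSpace ℝ (Fin m)) (hu : ∀ i, u i ∈ U)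
    (hinv : ∀ i, ∀ w ∈ W, A (x i) + B (u i) + w ∈ convexHull ℝ (Set.range x)) :
    ∀ xp ∈ convexHull ℝ (Set.range x), ∀ lam : Fin N → ℝ,
      (∀ i, 0 ≤ lam i) → (∑ i, lam i) = 1 → xp = ∑ i, lam i • x i →
        (∑ i, lam i • u i) ∈ U ∧
        ∀ w ∈ W, A xp + B (∑ i, lam i • u i) + w ∈ convexHull ℝ (Set.range x) := by
  intro xp _ lam h0 h1 hx
  refine ⟨hU.sum_mem (fun i _ => h0 i) h1 (fun i _ => hu i), fun w hw => ?_⟩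
  have key := (convex_convexHull ℝ (Set.range x)).sum_mem (t := Finset.univ)
    (fun i _ => h0 i) h1 (fun i _ => hinv i w hw)
  have e : A xp + B (∑ i, lam i • u i) + w = ∑ i, lam i • (A (x i) + B (u i) + w) := by
    simp only [hx, map_sum, map_smul, smul_add, Finset.sum_add_distrib, ← Finset.sum_smul, h1,
      one_smul]
  rw [e]
  exact key
end

section
/- Let A : ℝ^n → ℝ^n and B : ℝ^m → ℝ^n be linear maps, let U ⊆ ℝ^m be a convex set, let W ⊆ ℝ^n be a set, and let x_1, …, x_N ∈ ℝ^n and u_1, …, u_N ∈ U be such that for every i and every w ∈ W, A x_i + B u_i + w ∈ convexHull{x_1, …, x_N}. Let S = convexHull{x_1, …, x_N}. Then for every initial state z_0 ∈ S and every disturbance sequence (w_k)_{k≥0} with w_k ∈ W, there exists an input sequence (ū_k)_{k≥0} such that for every k: ū_k ∈ U, A z_k + B ū_k + w ∈ S for every w ∈ W, and the resulting closed-loop state z_{k+1} = A z_k + B ū_k + w_k again lies in S. -/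
/-- Theorem 1 (essence, recursive feasibility): starting from any state in the safe set
(the convex hull of stored states, each with an admissible stored input robustly steering
it back into the hull), along every disturbance realization there is a sequence of
admissible inputs keeping the closed-loop state in the safe set while robustly steering
into the safe set at each step. -/
theorem recursive_feasibility {n m N : ℕ}
    (A : EuclideanSpace ℝ (Fin n) →ₗ[ℝ] EuclideanSpace ℝ (Fin n))
    (B : EuclideanSpace ℝ (Fin m) →ₗ[ℝ] EuclideanSpace ℝ (Fin n))
    (U : Set (EuclideanSpace ℝ (Fin m))) (hU : Convex ℝ U)
    (W : Set (EuclideanSpace ℝ (Fin n)))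
    (x : Fin N → EuclideanSpace ℝ (Fin n))
    (u : Fin N → EuclideanSpace ℝ (Fin m)) (hu : ∀ i, u i ∈ U)
    (hinv : ∀ i, ∀ w ∈ W, A (x i) + B (u i) + w ∈ convexHull ℝ (Set.range x))
    (S : Set (EuclideanSpace ℝ (Fin n))) (hSdef : S = convexHull ℝ (Set.range x))
    (z0 : EuclideanSpace ℝ (Fin n)) (hz0 : z0 ∈ S)
    (w : ℕ → EuclideanSpace ℝ (Fin n)) (hw : ∀ k, w k ∈ W) :
    ∃ ubar : ℕ → EuclideanSpace ℝ (Fin m), ∃ z : ℕ → EuclideanSpace ℝ (Fin n),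
      z 0 = z0 ∧
      (∀ k, z (k + 1) = A (z k) + B (ubar k) + w k) ∧
      (∀ k, ubar k ∈ U ∧ (∀ w' ∈ W, A (z k) + B (ubar k) + w' ∈ S) ∧ z (k + 1) ∈ S) := by
  have key : ∀ z, ∃ v, z ∈ S → v ∈ U ∧ ∀ w' ∈ W, A z + B v + w' ∈ S := by
    have hS : Convex ℝ S := hSdef ▸ convex_convexHull ℝ _
    have hT : Convex ℝ {z | ∃ v, v ∈ U ∧ ∀ w' ∈ W, A z + B v + w' ∈ S} := by
      rintro p ⟨v, hv, hp⟩ q ⟨v', hv', hq⟩ a b ha hb hab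
      refine ⟨a • v + b • v', hU hv hv' ha hb hab, fun w' hw' => ?_⟩
      have h := hS (hp w' hw') (hq w' hw') ha hb hab
      have e : A (a • p + b • q) + B (a • v + b • v') + w'
          = a • (A p + B v + w') + b • (A q + B v' + w') := by
        have e1 : w' = a • w' + b • w' := by rw [← add_smul, hab, one_smul]
        simp only [map_add, map_smul, smul_add]
        nth_rewrite 1 [e1]
        abel
      rw [e]
      exact h
    intro z
    by_cases hz : z ∈ S
    · have hsub : convexHull ℝ (Set.range x) ⊆
          {z | ∃ v, v ∈ U ∧ ∀ w' ∈ W, A z + B v + w' ∈ S} := by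
        refine convexHull_min ?_ hT
        rintro _ ⟨i, rfl⟩
        exact ⟨u i, hu i, fun w' hw' => hSdef ▸ hinv i w' hw'⟩
      obtain ⟨v, hv⟩ := hsub (hSdef ▸ hz)
      exact ⟨v, fun _ => hv⟩
    · exact ⟨0, fun h => absurd h hz⟩
  choose f hf using key
  let z : ℕ → EuclideanSpace ℝ (Fin n) :=
    fun k => Nat.rec z0 (fun k y => A y + B (f y) + w k) k
  have hz : ∀ k, z k ∈ S := by
    intro k
    induction k with
    | zero => exact hz0
    | succ k ih => exact (hf (z k) ih).2 (w k) (hw k)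
  exact ⟨fun k => f (z k), z, rfl, fun _ => rfl,
    fun k => ⟨(hf _ (hz k)).1, (hf _ (hz k)).2, hz (k + 1)⟩⟩
end

section
/- Let P be a Borel probability measure on ℝ^n whose support is contained in a compact set W ⊆ ℝ^n, let L ≥ 0 and δ ≥ 0, let Q : ℝ^n → ℝ be Lipschitz with constant L, let w̃_1, …, w̃_M ∈ ℝ^n, and let μ_1, …, μ_M : ℝ^n → ℝ be bounded measurable functions such that for P-almost every w: μ_m(w) ≥ 0 for every m, Σ_{m=1}^M μ_m(w) = 1, w = Σ_{m=1}^M μ_m(w) · w̃_m, and ‖w − w̃_m‖ ≤ δ for every m with μ_m(w) ≠ 0. Set p_m = ∫ μ_m(w) dP(w). Then for every x ∈ ℝ^n, ∫ Q(x + w) dP(w) ≥ Σ_{m=1}^M p_m Q(x + w̃_m) − L δ. -/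
open MeasureTheory

/-- Proposition 8: the discrete-sum approximation overestimates the true expectation of
the Lipschitz function `Q` by at most `L * δ`. -/
theorem discrete_approximation_error_bound {n M : ℕ}
    (P : Measure (EuclideanSpace ℝ (Fin n))) [IsProbabilityMeasure P]
    (W : Set (EuclideanSpace ℝ (Fin n))) (hW : IsCompact W)
    (hsupp : ∀ᵐ w ∂P, w ∈ W)
    (L : ℝ) (hL : 0 ≤ L) (δ : ℝ) (hδ : 0 ≤ δ)
    (Q : EuclideanSpace ℝ (Fin n) → ℝ)
    (hQ : ∀ a b : EuclideanSpace ℝ (Fin n), |Q a - Q b| ≤ L * ‖a - b‖)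
    (wS : Fin M → EuclideanSpace ℝ (Fin n))
    (μ : Fin M → EuclideanSpace ℝ (Fin n) → ℝ)
    (hmeas : ∀ m, Measurable (μ m))
    (hbdd : ∀ m, ∃ C : ℝ, ∀ w, |μ m w| ≤ C)
    (hae : ∀ᵐ w ∂P,
      (∀ m, 0 ≤ μ m w) ∧ (∑ m, μ m w) = 1 ∧ w = (∑ m, μ m w • wS m) ∧
      ∀ m, μ m w ≠ 0 → ‖w - wS m‖ ≤ δ)
    (x : EuclideanSpace ℝ (Fin n)) :
    (∫ w, Q (x + w) ∂P) ≥ (∑ m, (∫ w, μ m w ∂P) * Q (x + wS m)) - L * δ := by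
  have hcont : Continuous Q := by
    have : LipschitzWith (Real.toNNReal L) Q := by
      apply LipschitzWith.of_dist_le_mul
      intro a b
      rw [Real.dist_eq, dist_eq_norm, Real.coe_toNNReal L hL]
      exact hQ a b
    exact this.continuous
  have hc : Continuous (fun w => Q (x + w)) := by fun_prop
  have hiQ : Integrable (fun w => Q (x + w)) P := by
    obtain ⟨C, hC⟩ := hW.exists_bound_of_continuousOn hc.continuousOn
    refine Integrable.of_bound hc.aestronglyMeasurable C ?_
    filter_upwards [hsupp] with w hw using hC w hw
  have hiμ : ∀ m, Integrable (μ m) P := by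
    intro m
    obtain ⟨C, hC⟩ := hbdd m
    exact Integrable.of_bound (hmeas m).aestronglyMeasurable C (Filter.Eventually.of_forall hC)
  have his : ∀ m ∈ Finset.univ, Integrable (fun w => μ m w * Q (x + wS m)) P :=
    fun m _ => (hiμ m).mul_const _
  have key : ∫ w, (∑ m, μ m w * Q (x + wS m)) ∂P ≤ ∫ w, (Q (x + w) + L * δ) ∂P := by
    apply integral_mono_ae (integrable_finset_sum _ his) (hiQ.add (integrable_const _))
    filter_upwards [hae] with w hw
    obtain ⟨h0, h1, -, h3⟩ := hw
    calc ∑ m, μ m w * Q (x + wS m) ≤ ∑ m, μ m w * (Q (x + w) + L * δ) := by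
          apply Finset.sum_le_sum
          intro m _
          by_cases hm : μ m w = 0
          · simp [hm]
          · apply mul_le_mul_of_nonneg_left _ (h0 m)
            have h4 := (abs_le.1 (hQ (x + w) (x + wS m))).1
            rw [add_sub_add_left_eq_sub] at h4
            have h5 := mul_le_mul_of_nonneg_left (h3 m hm) hL
            linarith
      _ = Q (x + w) + L * δ := by rw [← Finset.sum_mul, h1, one_mul]
  rw [integral_finset_sum _ his, integral_add hiQ (integrable_const _)] at key
  simp only [integral_mul_const, integral_const, probReal_univ, one_smul] at key
  linarith
end

section
/- Given a Borel probability measure P on ℝ^n, linear maps A : ℝ^n → ℝ^n and B : ℝ^m → ℝ^n, and a measurable policy π : ℝ^n → ℝ^m, define the closed-loop map f(x) = A x + B π(x) and the transition operator T on bounded measurable functions g : ℝ^n → ℝ by (T g)(x) = ∫ g(f(x) + w) dP(w). Let ℓ̂ : ℝ^n → ℝ and V : ℝ^n → ℝ be bounded measurable functions with ℓ̂ ≥ 0, V ≥ 0, and suppose V(x) ≥ ℓ̂(x) + (T V)(x) for every x ∈ ℝ^n. Then for every x_0 ∈ ℝ^n, the expected stage cost at time k tends to zero: lim_{k→∞}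 (T^k ℓ̂)(x_0) = 0. -/
open MeasureTheory

/-- The one-step transition operator of the closed-loop stochastic system:
`(T g)(x) = ∫ g (f x + w) dP(w)`. -/
noncomputable def transitionOperator {n : ℕ} (P : Measure (EuclideanSpace ℝ (Fin n)))
    (f : EuclideanSpace ℝ (Fin n) → EuclideanSpace ℝ (Fin n)) :
    (EuclideanSpace ℝ (Fin n) → ℝ) → (EuclideanSpace ℝ (Fin n) → ℝ) :=
  fun g x => ∫ w, g (f x + w) ∂P

section aux

variable {n : ℕ}

def AuxGood (g : EuclideanSpace ℝ (Fin n) → ℝ) : Prop :=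
  Measurable g ∧ ∃ C : ℝ, ∀ x, |g x| ≤ C

theorem AuxGood.integrable {g : EuclideanSpace ℝ (Fin n) → ℝ} (hg : AuxGood g)
    (P : Measure (EuclideanSpace ℝ (Fin n))) [IsProbabilityMeasure P]
    (y : EuclideanSpace ℝ (Fin n)) : Integrable (fun w => g (y + w)) P := by
  obtain ⟨hm, C, hC⟩ := hg
  refine Integrable.of_bound (C := C) ?_ ?_
  · exact (hm.comp (measurable_const_add y)).aestronglyMeasurable
  · exact Filter.Eventually.of_forall fun w => by simpa using hC (y + w)

theorem AuxGood.step {g : EuclideanSpace ℝ (Fin n) → ℝ} (hg : AuxGood g)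
    (P : Measure (EuclideanSpace ℝ (Fin n))) [IsProbabilityMeasure P]
    (f : EuclideanSpace ℝ (Fin n) → EuclideanSpace ℝ (Fin n)) (hf : Measurable f) :
    AuxGood (transitionOperator P f g) := by
  obtain ⟨hm, C, hC⟩ := hg
  refine ⟨?_, C, fun x => ?_⟩
  · have h : Measurable (fun p : EuclideanSpace ℝ (Fin n) × EuclideanSpace ℝ (Fin n) =>
        g (f p.1 + p.2)) := hm.comp ((hf.comp measurable_fst).add measurable_snd)
    exact (h.stronglyMeasurable.integral_prod_right (ν := P)).measurable
  · have := norm_integral_le_of_norm_le_const (μ := P) (f := fun w => g (f x + w)) (C := C)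
      (Filter.Eventually.of_forall fun w => by simpa using hC (f x + w))
    simpa [transitionOperator] using this

theorem aux_iter (P : Measure (EuclideanSpace ℝ (Fin n))) [IsProbabilityMeasure P]
    (f : EuclideanSpace ℝ (Fin n) → EuclideanSpace ℝ (Fin n)) (hf : Measurable f)
    (k : ℕ) : ∀ (l V W : EuclideanSpace ℝ (Fin n) → ℝ), AuxGood l → AuxGood V → AuxGood W →
    (∀ x, 0 ≤ l x) → (∀ x, 0 ≤ W x) → (∀ x, l x + W x ≤ V x) →
    ∀ x, 0 ≤ (transitionOperator P f)^[k] l x ∧ 0 ≤ (transitionOperator P f)^[k] W x ∧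
      (transitionOperator P f)^[k] l x + (transitionOperator P f)^[k] W x
        ≤ (transitionOperator P f)^[k] V x := by
  induction k with
  | zero => intro l V W _ _ _ h1 h2 h3 x; exact ⟨h1 x, h2 x, h3 x⟩
  | succ k ih =>
    intro l V W hl hV hW h1 h2 h3
    simp only [Function.iterate_succ, Function.comp]
    refine ih _ _ _ (hl.step P f hf) (hV.step P f hf) (hW.step P f hf)
      (fun x => integral_nonneg fun w => h1 _) (fun x => integral_nonneg fun w => h2 _) ?_
    intro x
    unfold transitionOperator
    rw [← integral_add (hl.integrable P _) (hW.integrable P _)]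
    exact integral_mono ((hl.integrable P _).add (hW.integrable P _)) (hV.integrable P _)
      fun w => h3 _

end aux

/-- Convergence step of Theorem 2: under the dissipation inequality `V ≥ ℓ + T V`,
the expected stage cost at time `k` tends to zero as `k → ∞`. -/
theorem expected_stage_cost_tendsto_zero {n m : ℕ}
    (P : Measure (EuclideanSpace ℝ (Fin n))) [IsProbabilityMeasure P]
    (A : EuclideanSpace ℝ (Fin n) →ₗ[ℝ] EuclideanSpace ℝ (Fin n))
    (B : EuclideanSpace ℝ (Fin m) →ₗ[ℝ] EuclideanSpace ℝ (Fin n))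
    (pol : EuclideanSpace ℝ (Fin n) → EuclideanSpace ℝ (Fin m)) (hpol : Measurable pol)
    (f : EuclideanSpace ℝ (Fin n) → EuclideanSpace ℝ (Fin n))
    (hf : ∀ x, f x = A x + B (pol x))
    (ℓ V : EuclideanSpace ℝ (Fin n) → ℝ)
    (hℓmeas : Measurable ℓ) (hℓbdd : ∃ C : ℝ, ∀ x, |ℓ x| ≤ C) (hℓ0 : ∀ x, 0 ≤ ℓ x)
    (hVmeas : Measurable V) (hVbdd : ∃ C : ℝ, ∀ x, |V x| ≤ C) (hV0 : ∀ x, 0 ≤ V x)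
    (hdissip : ∀ x, V x ≥ ℓ x + transitionOperator P f V x)
    (x₀ : EuclideanSpace ℝ (Fin n)) :
    Filter.Tendsto (fun k => (transitionOperator P f)^[k] ℓ x₀)
      Filter.atTop (nhds 0) := by
  have hfm : Measurable f := by
    have : f = fun x => A x + B (pol x) := funext hf
    rw [this]
    exact A.continuous_of_finiteDimensional.measurable.add
      (B.continuous_of_finiteDimensional.measurable.comp hpol)
  have hl : AuxGood ℓ := ⟨hℓmeas, hℓbdd⟩
  have hV : AuxGood V := ⟨hVmeas, hVbdd⟩
  have key := fun k => aux_iter P f hfm k ℓ V (transitionOperator P f V) hl hV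
    (hV.step P f hfm) hℓ0 (fun x => integral_nonneg fun w => hV0 _) hdissip x₀
  have hb : ∀ N, ∑ k ∈ Finset.range N, (transitionOperator P f)^[k] ℓ x₀
      + (transitionOperator P f)^[N] V x₀ ≤ V x₀ := by
    intro N
    induction N with
    | zero => simp
    | succ N ih =>
      rw [Finset.sum_range_succ, Function.iterate_succ, Function.comp]
      linarith [(key N).2.2]
  refine (summable_of_sum_range_le (c := V x₀) (fun k => (key k).1) fun N => ?_).tendsto_atTop_zero
  linarith [hb N, (key N).1, (key N).2.1, (key N).2.2]
end

section
/- Given a Borel probability measure P on ℝ^n, linear maps A : ℝ^n → ℝ^n and B : ℝ^m → ℝ^n, and a measurable policy π : ℝ^n → ℝ^m, define the closed-loop map f(x) = A x + B π(x) and the transition operator T on bounded measurable functions g : ℝ^n → ℝ by (T g)(x) = ∫ g(f(x) + w) dP(w). Let ε ≥ 0, let ℓ̂ : ℝ^n → ℝ be a bounded measurable function with ℓ̂ ≥ 0, and let V : ℝ^n → ℝ be a bounded measurable function with V ≥ 0 such that V(x) ≤ ℓ̂(x) + (T V)(x) + ε for every x ∈ ℝ^n. If x_0 ∈ ℝ^n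 and N ≥ 1 satisfy (T^N V)(x_0) = 0, then V(x_0) ≤ Σ_{k=0}^{N−1} (T^k ℓ̂)(x_0) + N ε. -/
open MeasureTheory

theorem transOp_good {n : ℕ} (P : Measure (EuclideanSpace ℝ (Fin n))) [IsProbabilityMeasure P]
    (f : EuclideanSpace ℝ (Fin n) → EuclideanSpace ℝ (Fin n)) (hf : Measurable f)
    (g : EuclideanSpace ℝ (Fin n) → ℝ) (hg : Measurable g ∧ ∃ C : ℝ, ∀ x, |g x| ≤ C) :
    Measurable (transitionOperator P f g) ∧ ∃ C : ℝ, ∀ x, |transitionOperator P f g x| ≤ C := by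
  obtain ⟨hm, C, hC⟩ := hg
  refine ⟨?_, C, fun x => ?_⟩
  · have h : Measurable (fun p : EuclideanSpace ℝ (Fin n) × EuclideanSpace ℝ (Fin n) =>
        g (f p.1 + p.2)) := by fun_prop
    exact (h.stronglyMeasurable.integral_prod_right (ν := P)).measurable
  · have := norm_integral_le_of_norm_le_const (μ := P) (f := fun w => g (f x + w)) (C := C)
      (Filter.Eventually.of_forall fun w => hC _)
    simpa [transitionOperator] using this

theorem transOp_iter_good {n : ℕ} (P : Measure (EuclideanSpace ℝ (Fin n)))
    [IsProbabilityMeasure P]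
    (f : EuclideanSpace ℝ (Fin n) → EuclideanSpace ℝ (Fin n)) (hf : Measurable f)
    (g : EuclideanSpace ℝ (Fin n) → ℝ) (hg : Measurable g ∧ ∃ C : ℝ, ∀ x, |g x| ≤ C) (k : ℕ) :
    Measurable ((transitionOperator P f)^[k] g) ∧
      ∃ C : ℝ, ∀ x, |(transitionOperator P f)^[k] g x| ≤ C := by
  induction k with
  | zero => exact hg
  | succ k ih =>
    rw [Function.iterate_succ_apply']
    exact transOp_good P f hf _ ih

theorem transOp_integrable {n : ℕ} (P : Measure (EuclideanSpace ℝ (Fin n)))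
    [IsProbabilityMeasure P] (y : EuclideanSpace ℝ (Fin n))
    (g : EuclideanSpace ℝ (Fin n) → ℝ) (hg : Measurable g ∧ ∃ C : ℝ, ∀ x, |g x| ≤ C) :
    Integrable (fun w => g (y + w)) P := by
  obtain ⟨hm, C, hC⟩ := hg
  have h : Measurable (fun w => g (y + w)) := by fun_prop
  exact Integrable.of_bound h.aestronglyMeasurable C (Filter.Eventually.of_forall fun w => hC _)

/-- Recursive error-accumulation argument (inequalities (46)–(47) in Theorem 3): under
the approximate Bellman inequality `V ≤ ℓ + T V + ε`, if the expected value of `V` at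
time `N` vanishes, then `V x₀` is bounded by the expected accumulated stage cost over
`N` steps plus the accumulated error `N ε`. -/
theorem approximate_bellman_error_accumulation {n m : ℕ}
    (P : Measure (EuclideanSpace ℝ (Fin n))) [IsProbabilityMeasure P]
    (A : EuclideanSpace ℝ (Fin n) →ₗ[ℝ] EuclideanSpace ℝ (Fin n))
    (B : EuclideanSpace ℝ (Fin m) →ₗ[ℝ] EuclideanSpace ℝ (Fin n))
    (pol : EuclideanSpace ℝ (Fin n) → EuclideanSpace ℝ (Fin m)) (hpol : Measurable pol)
    (f : EuclideanSpace ℝ (Fin n) → EuclideanSpace ℝ (Fin n))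
    (hf : ∀ x, f x = A x + B (pol x))
    (ε : ℝ) (hε : 0 ≤ ε)
    (ℓ V : EuclideanSpace ℝ (Fin n) → ℝ)
    (hℓmeas : Measurable ℓ) (hℓbdd : ∃ C : ℝ, ∀ x, |ℓ x| ≤ C) (hℓ0 : ∀ x, 0 ≤ ℓ x)
    (hVmeas : Measurable V) (hVbdd : ∃ C : ℝ, ∀ x, |V x| ≤ C) (hV0 : ∀ x, 0 ≤ V x)
    (hbell : ∀ x, V x ≤ ℓ x + transitionOperator P f V x + ε)
    (x₀ : EuclideanSpace ℝ (Fin n)) (N : ℕ) (hN : 1 ≤ N)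
    (hterm : (transitionOperator P f)^[N] V x₀ = 0) :
    V x₀ ≤ (∑ k ∈ Finset.range N, (transitionOperator P f)^[k] ℓ x₀) + N * ε := by
  have hfm : Measurable f := by
    have hA : Measurable A := A.continuous_of_finiteDimensional.measurable
    have hB : Measurable B := B.continuous_of_finiteDimensional.measurable
    rw [funext hf]
    exact hA.add (hB.comp hpol)
  have gV := transOp_iter_good P f hfm V ⟨hVmeas, hVbdd⟩
  have gl := transOp_iter_good P f hfm ℓ ⟨hℓmeas, hℓbdd⟩
  have key : ∀ k x, (transitionOperator P f)^[k] V x ≤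
      (transitionOperator P f)^[k] ℓ x + (transitionOperator P f)^[k+1] V x + ε := by
    intro k
    induction k with
    | zero => exact hbell
    | succ k ih =>
      intro x
      have iV := transOp_integrable P (f x) _ (gV k)
      have iV' := transOp_integrable P (f x) _ (gV (k+1))
      have il := transOp_integrable P (f x) _ (gl k)
      have h := integral_mono iV ((il.add iV').add (integrable_const ε)) (fun w => ih (f x + w))
      rw [integral_add' (il.add iV') (integrable_const ε), integral_add' il iV'] at h
      simp only [integral_const, probReal_univ, one_smul] at h
      rw [Function.iterate_succ_apply' _ k V, Function.iterate_succ_apply' _ k ℓ,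
        Function.iterate_succ_apply' _ (k+1) V]
      exact h
  have main : ∀ M : ℕ, V x₀ ≤ (∑ k ∈ Finset.range M, (transitionOperator P f)^[k] ℓ x₀)
      + (transitionOperator P f)^[M] V x₀ + M * ε := by
    intro M
    induction M with
    | zero => simp
    | succ M ih =>
      have := key M x₀
      rw [Finset.sum_range_succ]
      push_cast
      linarith
  have := main N
  rw [hterm] at this
  linarith
end

section
/- Let P be a finite subset of ℝ^n containing at least two distinct points, let q_1, …, q_k be points in the intrinsic (relative) interior of the convex hull of P, let b_1, …, b_k ≥ 0 with Σ_j b_j = 1, and let w = Σ_j b_j q_j. Then there exist convex coefficients d_p ≥ 0 for p ∈ P with Σ_{p∈P} d_p = 1 and w = Σ_{p∈P} d_p p such that Σ_{j=1}^k b_j ‖q_j‖² < Σ_{p∈P} d_p ‖p‖². -/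
lemma rep_of_mem_hull {n : ℕ} (P : Finset (EuclideanSpace ℝ (Fin n)))
    (x : EuclideanSpace ℝ (Fin n))
    (hx : x ∈ convexHull ℝ (P : Set (EuclideanSpace ℝ (Fin n)))) :
    ∃ d : EuclideanSpace ℝ (Fin n) → ℝ,
      (∀ p ∈ P, 0 ≤ d p) ∧ (∑ p ∈ P, d p) = 1 ∧ (∑ p ∈ P, d p • p) = x ∧
      ‖x‖ ^ 2 ≤ ∑ p ∈ P, d p * ‖p‖ ^ 2 := by
  obtain ⟨d, h0, h1, h2⟩ := Finset.mem_convexHull'.1 hx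
  refine ⟨d, h0, h1, h2, ?_⟩
  have hc : ConvexOn ℝ Set.univ (fun y : EuclideanSpace ℝ (Fin n) => ‖y‖ ^ 2) :=
    (convexOn_norm convex_univ).pow (fun _ _ => norm_nonneg _) 2
  have := hc.map_sum_le (t := P) (w := d) (p := fun p => p) h0 h1 (fun _ _ => Set.mem_univ _)
  simpa [h2] using this

lemma exists_seg {n : ℕ} (C : Set (EuclideanSpace ℝ (Fin n)))
    (q u v : EuclideanSpace ℝ (Fin n)) (hu : u ∈ C) (hv : v ∈ C)
    (hq : q ∈ intrinsicInterior ℝ C) :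
    ∃ e : ℝ, 0 < e ∧ q + e • (v - u) ∈ C ∧ q - e • (v - u) ∈ C := by
  obtain ⟨x, hx, rfl⟩ := mem_intrinsicInterior.1 hq
  have hm : ∀ t : ℝ, t • (v - u) + (x : EuclideanSpace ℝ (Fin n)) ∈ affineSpan ℝ C := fun t =>
    AffineSubspace.vadd_mem_of_mem_direction (Submodule.smul_mem _ _
      (AffineSubspace.vsub_mem_direction (subset_affineSpan ℝ C hv)
        (subset_affineSpan ℝ C hu))) x.2
  let f : ℝ → affineSpan ℝ C := fun t => ⟨t • (v - u) + x, hm t⟩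
  have hf : Continuous f := by
    apply Continuous.subtype_mk
    fun_prop
  have hf0 : f 0 = x := by ext1; simp [f]
  have hn : f ⁻¹' ((↑) ⁻¹' C) ∈ nhds (0 : ℝ) :=
    hf.continuousAt.preimage_mem_nhds (by rw [hf0]; exact mem_interior_iff_mem_nhds.1 hx)
  obtain ⟨e, he, hb⟩ := Metric.mem_nhds_iff.1 hn
  refine ⟨e / 2, by positivity, ?_, ?_⟩
  · have : (e / 2) ∈ Metric.ball (0 : ℝ) e := by
      simp [abs_of_pos he]; linarith
    have := hb this
    simp only [f, Set.mem_preimage] at this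
    rwa [add_comm] at this
  · have : (-(e / 2)) ∈ Metric.ball (0 : ℝ) e := by
      simp [abs_of_pos he]; linarith
    have := hb this
    simp only [f, Set.mem_preimage] at this
    rwa [add_comm, neg_smul, ← sub_eq_add_neg] at this

lemma strict_rep {n : ℕ} (P : Finset (EuclideanSpace ℝ (Fin n)))
    (hP : ∃ a ∈ P, ∃ b ∈ P, a ≠ b) (q : EuclideanSpace ℝ (Fin n))
    (hq : q ∈ intrinsicInterior ℝ (convexHull ℝ (P : Set (EuclideanSpace ℝ (Fin n))))) :
    ∃ d : EuclideanSpace ℝ (Fin n) → ℝ,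
      (∀ p ∈ P, 0 ≤ d p) ∧ (∑ p ∈ P, d p) = 1 ∧ (∑ p ∈ P, d p • p) = q ∧
      ‖q‖ ^ 2 < ∑ p ∈ P, d p * ‖p‖ ^ 2 := by
  obtain ⟨u, hu, v, hv, huv⟩ := hP
  obtain ⟨e, he, h1, h2⟩ := exists_seg _ q u v (subset_convexHull ℝ _ hu)
    (subset_convexHull ℝ _ hv) hq
  obtain ⟨d, d0, d1, d2, d3⟩ := rep_of_mem_hull P _ h1
  obtain ⟨c, c0, c1, c2, c3⟩ := rep_of_mem_hull P _ h2
  refine ⟨fun p => (1 / 2) * (d p + c p), fun p hp => ?_, ?_, ?_, ?_⟩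
  · have := d0 p hp
    have := c0 p hp
    positivity
  · rw [← Finset.mul_sum, Finset.sum_add_distrib, d1, c1]; norm_num
  · simp only [mul_smul, add_smul]
    rw [← Finset.smul_sum, Finset.sum_add_distrib, d2, c2]
    module
  · simp only [mul_assoc, add_mul]
    rw [← Finset.mul_sum, Finset.sum_add_distrib]
    have hpl := parallelogram_law_with_norm ℝ q (e • (v - u))
    have : 0 < ‖e • (v - u)‖ :=
      norm_pos_iff.2 (smul_ne_zero he.ne' (sub_ne_zero.2 huv.symm))
    nlinarith [mul_pos this this]

/-- Quantitative core of Proposition 11: if `w` is a convex combination of points `q j`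
lying in the relative interior of the convex hull of a finite set `P` with at least two
distinct points, then there is a convex representation of `w` over `P` whose
squared-norm cost strictly dominates that of the given representation. -/
theorem relint_representation_strict_cost_increase {n k : ℕ}
    (P : Finset (EuclideanSpace ℝ (Fin n)))
    (hP : ∃ a ∈ P, ∃ b ∈ P, a ≠ b)
    (q : Fin k → EuclideanSpace ℝ (Fin n))
    (hq : ∀ j, q j ∈
      intrinsicInterior ℝ (convexHull ℝ (P : Set (EuclideanSpace ℝ (Fin n)))))
    (b : Fin k → ℝ) (hb0 : ∀ j, 0 ≤ b j) (hb1 : (∑ j, b j) = 1)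
    (w : EuclideanSpace ℝ (Fin n)) (hw : w = ∑ j, b j • q j) :
    ∃ d : EuclideanSpace ℝ (Fin n) → ℝ,
      (∀ p ∈ P, 0 ≤ d p) ∧ (∑ p ∈ P, d p) = 1 ∧ (∑ p ∈ P, d p • p) = w ∧
      (∑ j, b j * ‖q j‖ ^ 2) < ∑ p ∈ P, d p * ‖p‖ ^ 2 := by
  choose d d0 d1 d2 d3 using fun j => strict_rep P hP (q j) (hq j)
  refine ⟨fun p => ∑ j, b j * d j p, fun p hp => ?_, ?_, ?_, ?_⟩
  · exact Finset.sum_nonneg fun j _ => mul_nonneg (hb0 j) (d0 j p hp)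
  · rw [Finset.sum_comm]
    simp only [← Finset.mul_sum, d1, mul_one, hb1]
  · simp only [Finset.sum_smul, mul_smul]
    rw [Finset.sum_comm]
    simp only [← Finset.smul_sum, d2, hw]
  · simp only [Finset.sum_mul, mul_assoc]
    rw [Finset.sum_comm]
    simp only [← Finset.mul_sum]
    obtain ⟨j, _, hj⟩ : ∃ j ∈ Finset.univ, b j ≠ 0 :=
      Finset.exists_ne_zero_of_sum_ne_zero (by rw [hb1]; exact one_ne_zero)
    exact Finset.sum_lt_sum (fun i _ => mul_le_mul_of_nonneg_left (d3 i).le (hb0 i))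
      ⟨j, Finset.mem_univ _, mul_lt_mul_of_pos_left (d3 j) (lt_of_le_of_ne (hb0 j) hj.symm)⟩
end
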